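/- arXiv:1212.1041 — 10 statements merged into one kernel-verified Lean document; each statement's English description precedes it below -/
import Mathlib

section
/- The value of the Riemann zeta function at 3 satisfies ζ(3) = -8π² · [ (1/16)·( ln(2π)/3 + 9·ln(3/2) - 9/2 ) - ∑_{l=1}^∞ C_l · (ζ(2l) - 1) ], where C_l = 1 / (16 · 4^l · l(l+1)(2l+1)(2l+3)). -/
open Real

/-- The coefficients `C_l = 1 / (16 · 4^l · l(l+1)(2l+1)(2l+3))`. -/
noncomputable def C (l : ℕ) : ℝ :=
  1 / (16 * 4 ^ l * l * (l + 1) * (2 * l + 1) * (2 * l + 3))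

open Filter Topology MeasureTheory

/-- Riemann–Lebesgue lemma for half-integer cosine frequencies. -/
theorem tendsto_integral_mul_cos_odd {f : ℝ → ℝ} {a b : ℝ}
    (hf : IntervalIntegrable f volume a b) (hab : a ≤ b) :
    Tendsto (fun N : ℕ => ∫ x in a..b, f x * cos ((2 * N + 1) * π * x)) atTop (𝓝 0) := by
  have hF : Integrable ((Set.Ioc a b).indicator f) := by
    rw [integrable_indicator_iff measurableSet_Ioc]
    exact (intervalIntegrable_iff_integrableOn_Ioc_of_le hab).1 hf
  have hRL := Real.tendsto_integral_exp_smul_cocompact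
    (fun x => (((Set.Ioc a b).indicator f x : ℝ) : ℂ))
  have hw : Tendsto (fun N : ℕ => (2 * (N : ℝ) + 1) / 2) atTop (cocompact ℝ) := by
    refine Tendsto.mono_right ?_ atTop_le_cocompact
    refine Tendsto.atTop_div_const (by norm_num) (tendsto_atTop_add_const_right _ _ ?_)
    exact tendsto_natCast_atTop_atTop.const_mul_atTop (by norm_num)
  have h := (Complex.continuous_re.tendsto _).comp (hRL.comp hw)
  simp only [Complex.zero_re] at h
  refine h.congr fun N => ?_
  simp only [Function.comp_apply]
  rw [intervalIntegral.integral_of_le hab, ← integral_indicator measurableSet_Ioc]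
  have hint : Integrable (fun v : ℝ => Real.fourierChar (-(v * ((2 * (N : ℝ) + 1) / 2))) •
      (((Set.Ioc a b).indicator f v : ℝ) : ℂ)) := by
    exact (VectorFourier.fourierIntegral_convergent_iff Real.continuous_fourierChar
      (L := innerₗ ℝ) (by exact continuous_inner) ((2 * (N : ℝ) + 1) / 2)).2 hF.ofReal |>.congr
        (by filter_upwards with v; simp [mul_comm])
  have := integral_re hint
  simp only [RCLike.re_eq_complex_re] at this
  rw [← this]
  refine integral_congr_ae (Eventually.of_forall fun v => ?_)
  simp only [Circle.smul_def, smul_eq_mul, Real.fourierChar_apply, Complex.re_mul_ofReal,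
    Set.indicator_apply]
  rw [Complex.exp_ofReal_mul_I_re, ← cos_neg]
  split_ifs
  · rw [mul_comm]; congr 2; ring
  · simp

/-- The Dirichlet kernel expansion of the cotangent. -/
theorem cos_div_sin_eq_sum_add {y : ℝ} (hy : sin y ≠ 0) (N : ℕ) :
    cos y / sin y = 2 * ∑ k ∈ Finset.range N, sin (2 * (k + 1) * y) +
      cos ((2 * N + 1) * y) / sin y := by
  induction N with
  | zero => simp
  | succ N ih =>
    have h : cos ((2 * N + 1) * y) - cos ((2 * (N + 1 : ℕ) + 1) * y)
        = 2 * sin (2 * (N + 1) * y) * sin y := by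
      rw [cos_sub_cos]
      push_cast
      rw [show ((2 * (N : ℝ) + 1) * y + (2 * (N + 1) + 1) * y) / 2 = 2 * (N + 1) * y by ring,
        show ((2 * (N : ℝ) + 1) * y - (2 * (N + 1) + 1) * y) / 2 = - y by ring, sin_neg]
      ring
    have h' : cos ((2 * N + 1) * y) / sin y = 2 * sin (2 * (N + 1) * y)
        + cos ((2 * (N + 1 : ℕ) + 1) * y) / sin y := by
      rw [div_eq_iff hy, add_mul (2 * sin _), div_mul_cancel₀ _ hy]
      linarith
    rw [ih, Finset.sum_range_succ, h']
    ring

theorem integral_cubic_mul_sin (k : ℕ) :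
    ∫ x in (0 : ℝ)..(1 / 2), (1 - (1 - 2 * x) ^ 3) * sin (2 * (k + 1) * (π * x)) =
      (-1) ^ k / (2 * π * (k + 1)) + 3 / (π ^ 3 * (k + 1) ^ 3) := by
  have hk : (k : ℝ) + 1 ≠ 0 := by positivity
  have hπ := pi_ne_zero
  set a : ℝ := 2 * (k + 1) * π with ha
  have ha0 : a ≠ 0 := by positivity
  have hd : ∀ x : ℝ, HasDerivAt (fun x => -(1 - (1 - 2 * x) ^ 3) * cos (a * x) / a
      + 6 * (1 - 2 * x) ^ 2 * sin (a * x) / a ^ 2 - 24 * (1 - 2 * x) * cos (a * x) / a ^ 3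
      - 48 * sin (a * x) / a ^ 4) ((1 - (1 - 2 * x) ^ 3) * sin (a * x)) x := by
    intro x
    have hl : HasDerivAt (fun x : ℝ => 1 - 2 * x) (-2) x := by
      simpa using ((hasDerivAt_id x).const_mul 2).const_sub 1
    have hm : HasDerivAt (fun x : ℝ => a * x) a x := by
      simpa using (hasDerivAt_id x).const_mul a
    have := (((((hl.pow 3).const_sub 1).neg.mul hm.cos).div_const a).add
      ((((hl.pow 2).const_mul 6).mul hm.sin).div_const (a ^ 2)) |>.sub
      (((hl.const_mul 24).mul hm.cos).div_const (a ^ 3))).sub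
      ((hm.sin.const_mul 48).div_const (a ^ 4))
    convert! this using 1
    simp only [Pi.pow_apply, Pi.neg_apply]
    field_simp
    ring
  have hI := intervalIntegral.integral_eq_sub_of_hasDerivAt (a := 0) (b := 1 / 2)
    (fun x _ => hd x) (Continuous.intervalIntegrable (by fun_prop) _ _)
  rw [show (fun x : ℝ => (1 - (1 - 2 * x) ^ 3) * sin (2 * (k + 1) * (π * x))) =
    fun x => (1 - (1 - 2 * x) ^ 3) * sin (a * x) from by ext x; rw [ha]; ring_nf, hI]
  have h2 : a * (1 / 2) = (k + 1 : ℕ) * π := by rw [ha]; push_cast; ring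
  rw [h2, cos_nat_mul_pi, sin_nat_mul_pi, ha]
  simp
  field_simp
  ring

theorem tendsto_sum_alternating_inv :
    Tendsto (fun N : ℕ => ∑ k ∈ Finset.range (2 * N), (-1 : ℝ) ^ k / (k + 1)) atTop
      (𝓝 (log 2)) := by
  have h1 := Real.tendsto_harmonic_sub_log
  have h2 := h1.comp (tendsto_id.const_mul_atTop' (show 0 < 2 by norm_num))
  have h3 := (h2.sub h1).add_const (log 2)
  rw [sub_self, zero_add] at h3
  refine h3.congr' ?_
  filter_upwards [eventually_gt_atTop 0] with N hN
  have hs : ∀ N : ℕ, ∑ k ∈ Finset.range (2 * N), (-1 : ℝ) ^ k / (k + 1) =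
      harmonic (2 * N) - harmonic N := by
    intro N
    induction N with
    | zero => simp
    | succ N ih =>
      rw [show 2 * (N + 1) = 2 * N + 1 + 1 by ring, Finset.sum_range_succ,
        Finset.sum_range_succ, ih, harmonic_succ, harmonic_succ, harmonic_succ]
      push_cast
      rw [pow_succ, pow_mul]
      field_simp
      ring
  rw [hs]
  have : (N : ℝ) ≠ 0 := by positivity
  simp only [Function.comp_apply, id]
  push_cast
  rw [log_mul (by norm_num) this]
  ring

theorem sin_pi_mul_pos {x : ℝ} (hx : x ∈ Set.Ioc (0 : ℝ) (1 / 2)) : 0 < sin (π * x) := by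
  have hπ := pi_pos
  exact sin_pos_of_pos_of_lt_pi (mul_pos hπ hx.1) (by nlinarith [hx.2])

theorem intervalIntegrable_cubic_div_sin :
    IntervalIntegrable (fun x : ℝ => (1 - (1 - 2 * x) ^ 3) / sin (π * x)) volume 0 (1 / 2) := by
  rw [intervalIntegrable_iff_integrableOn_Ioc_of_le (by norm_num)]
  refine Measure.integrableOn_of_bounded (M := 3) (by simp) ?_ ?_
  · exact (Measurable.div (by fun_prop) (by fun_prop)).aestronglyMeasurable
  · rw [ae_restrict_iff' measurableSet_Ioc]
    refine Eventually.of_forall fun x hx => ?_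
    have hs := sin_pi_mul_pos hx
    have h2 : 2 * x ≤ sin (π * x) := by
      have := mul_le_sin (x := π * x) (mul_nonneg pi_pos.le hx.1.le)
        (by nlinarith [hx.2, pi_pos])
      rwa [← mul_assoc, div_mul_cancel₀ _ pi_ne_zero] at this
    have hx0 := hx.1
    have hx1 := hx.2
    have h3 : 0 ≤ 1 - (1 - 2 * x) ^ 3 := by
      nlinarith [mul_pos hx0 hx0, mul_pos hx0 (mul_pos hx0 hx0), sq_nonneg (x - 3 / 4)]
    rw [norm_of_nonneg (div_nonneg h3 hs.le), div_le_iff₀ hs]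
    nlinarith [mul_pos hx0 hx0, mul_nonneg (mul_pos hx0 hx0).le (by linarith : 0 ≤ 1 / 2 - x)]

theorem intervalIntegrable_cubic_mul_cot :
    IntervalIntegrable (fun x : ℝ => (1 - (1 - 2 * x) ^ 3) * (π * (cos (π * x) / sin (π * x))))
      volume 0 (1 / 2) := by
  have := intervalIntegrable_cubic_div_sin.mul_continuousOn
    (g := fun x => π * cos (π * x)) (by fun_prop)
  refine this.congr fun x _ => ?_
  ring

theorem integral_cubic_mul_cot :
    ∫ x in (0 : ℝ)..(1 / 2), (1 - (1 - 2 * x) ^ 3) * (π * (cos (π * x) / sin (π * x))) =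
      log 2 + 6 / π ^ 2 * ∑' n : ℕ, 1 / ((n : ℝ) + 1) ^ 3 := by
  have hsum : Summable fun n : ℕ => 1 / ((n : ℝ) + 1) ^ 3 := by
    have := (summable_nat_add_iff 1).2 (Real.summable_one_div_nat_pow.2 (show 1 < 3 by norm_num))
    simpa using this
  have h2N : Tendsto (fun N : ℕ => 2 * N) atTop atTop := tendsto_id.const_mul_atTop' (by norm_num)
  have hlim := (tendsto_sum_alternating_inv.add
    ((hsum.hasSum.tendsto_sum_nat.comp h2N).const_mul (6 / π ^ 2))).add
    (((tendsto_integral_mul_cos_odd intervalIntegrable_cubic_div_sin (by norm_num)).comp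
      h2N).const_mul π)
  rw [mul_zero, add_zero] at hlim
  refine tendsto_nhds_unique (tendsto_const_nhds.congr fun N => ?_) hlim
  have hint : ∀ k : ℕ, IntervalIntegrable
      (fun x : ℝ => (1 - (1 - 2 * x) ^ 3) * sin (2 * (k + 1) * (π * x))) volume 0 (1 / 2) :=
    fun k => Continuous.intervalIntegrable (by fun_prop) _ _
  have hcos : IntervalIntegrable (fun x : ℝ => (1 - (1 - 2 * x) ^ 3) / sin (π * x) *
      cos ((2 * (2 * N : ℕ) + 1) * π * x)) volume 0 (1 / 2) :=
    intervalIntegrable_cubic_div_sin.mul_continuousOn (by fun_prop)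
  have heq : ∫ x in (0 : ℝ)..(1 / 2), (1 - (1 - 2 * x) ^ 3) * (π * (cos (π * x) / sin (π * x))) =
      ∫ x in (0 : ℝ)..(1 / 2), (2 * π * (∑ k ∈ Finset.range (2 * N),
        (1 - (1 - 2 * x) ^ 3) * sin (2 * (k + 1) * (π * x))) +
        π * ((1 - (1 - 2 * x) ^ 3) / sin (π * x) * cos ((2 * (2 * N : ℕ) + 1) * π * x))) := by
    refine intervalIntegral.integral_congr_ae (Eventually.of_forall fun x hx => ?_)
    rw [Set.uIoc_of_le (by norm_num)] at hx
    rw [cos_div_sin_eq_sum_add (sin_pi_mul_pos hx).ne' (2 * N), ← Finset.mul_sum, ← mul_assoc]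
    ring_nf
  rw [heq, intervalIntegral.integral_add, intervalIntegral.integral_const_mul,
    intervalIntegral.integral_const_mul, intervalIntegral.integral_finsetSum fun k _ => hint k]
  · simp only [integral_cubic_mul_sin, Function.comp_apply]
    congr 1
    rw [Finset.mul_sum, Finset.mul_sum, ← Finset.sum_add_distrib]
    refine Finset.sum_congr rfl fun k _ => ?_
    have : (k : ℝ) + 1 ≠ 0 := by positivity
    field_simp
    ring
  · exact Continuous.intervalIntegrable (by fun_prop) _ _
  · exact hcos.const_mul _

theorem integral_elementary_part :
    ∫ x in (0 : ℝ)..(1 / 2), (1 - 2 * x) ^ 3 * (2 * x / (1 - x ^ 2)) =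
      35 / 3 - log 2 - 27 * log (3 / 2) := by
  have hu : Set.uIcc (0 : ℝ) (1 / 2) = Set.Icc 0 (1 / 2) := Set.uIcc_of_le (by norm_num)
  have hd : ∀ x ∈ Set.uIcc (0 : ℝ) (1 / 2), HasDerivAt
      (fun x : ℝ => 16 / 3 * x ^ 3 - 12 * x ^ 2 + 28 * x + log (1 - x) - 27 * log (1 + x))
      ((1 - 2 * x) ^ 3 * (2 * x / (1 - x ^ 2))) x := by
    intro x hx
    rw [hu] at hx
    have h1 : 1 - x ≠ 0 := by linarith [hx.2]
    have h2 : 1 + x ≠ 0 := by linarith [hx.1]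
    have h3 : 1 - x ^ 2 ≠ 0 := by
      rw [show 1 - x ^ 2 = (1 - x) * (1 + x) by ring]; exact mul_ne_zero h1 h2
    have := ((((((hasDerivAt_pow 3 x).const_mul (16 / 3)).sub
      ((hasDerivAt_pow 2 x).const_mul 12)).add ((hasDerivAt_id x).const_mul 28)).add
      (((hasDerivAt_id x).const_sub 1).log h1)).sub
      ((((hasDerivAt_id x).const_add 1).log h2).const_mul 27))
    convert! this using 1
    simp only [id]
    rw [show 1 - x ^ 2 = (1 - x) * (1 + x) by ring]
    field_simp
    ring
  rw [intervalIntegral.integral_eq_sub_of_hasDerivAt hd]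
  · rw [show (1 : ℝ) - 1 / 2 = 2⁻¹ by norm_num, log_inv, show (1 : ℝ) + 1 / 2 = 3 / 2 by norm_num]
    norm_num
    ring
  · refine ContinuousOn.intervalIntegrable ?_
    refine ContinuousOn.mul (by fun_prop) (ContinuousOn.div (by fun_prop) (by fun_prop) ?_)
    intro x hx
    rw [hu] at hx
    nlinarith [hx.1, hx.2]

theorem coeff_eq_integral (l : ℕ) :
    C (l + 1) = ∫ x in (0 : ℝ)..(1 / 2), 1 / 24 * (1 - 2 * x) ^ 3 * x ^ (2 * l + 1) := by
  have : (fun x : ℝ => 1 / 24 * (1 - 2 * x) ^ 3 * x ^ (2 * l + 1)) = fun x =>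
      1 / 24 * x ^ (2 * l + 1) - 1 / 4 * x ^ (2 * l + 2) + 1 / 2 * x ^ (2 * l + 3)
        - 1 / 3 * x ^ (2 * l + 4) := by
    ext x; ring
  have hi : ∀ (c : ℝ) (n : ℕ), IntervalIntegrable (fun x : ℝ => c * x ^ n) volume 0 (1 / 2) :=
    fun c n => Continuous.intervalIntegrable (by fun_prop) _ _
  rw [this, intervalIntegral.integral_sub (((hi _ _).sub (hi _ _)).add (hi _ _)) (hi _ _),
    intervalIntegral.integral_add ((hi _ _).sub (hi _ _)) (hi _ _),
    intervalIntegral.integral_sub (hi _ _) (hi _ _)]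
  simp only [intervalIntegral.integral_const_mul, integral_pow]
  rw [C]
  have h4 : (4 : ℝ) ^ (l + 1) = 2 ^ (2 * l + 2) := by
    rw [show 2 * l + 2 = 2 * (l + 1) by ring, pow_mul]; norm_num
  rw [h4]
  simp only [one_div, inv_pow, pow_succ]
  push_cast
  field_simp
  ring

/-- The tail `ζ(2l+2) - 1` as a real series. -/
noncomputable def zetaTail (l : ℕ) : ℝ := ∑' n : ℕ, 1 / ((n : ℝ) + 2) ^ (2 * l + 2)

theorem summable_zetaTail (l : ℕ) : Summable fun n : ℕ => 1 / ((n : ℝ) + 2) ^ (2 * l + 2) := by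
  have := (summable_nat_add_iff 2).2
    (Real.summable_one_div_nat_pow.2 (show 1 < 2 * l + 2 by omega))
  simpa using this

theorem zetaTail_nonneg (l : ℕ) : 0 ≤ zetaTail l := tsum_nonneg fun _ => by positivity

theorem zetaTail_le (l : ℕ) : zetaTail l ≤ zetaTail 0 := by
  refine (summable_zetaTail l).tsum_le_tsum (fun n => ?_) (summable_zetaTail 0)
  have : (1 : ℝ) ≤ n + 2 := by linarith [(Nat.cast_nonneg n : (0 : ℝ) ≤ n)]
  gcongr
  omega

theorem riemannZeta_even_sub_one (l : ℕ) :
    riemannZeta (2 * ((l + 1 : ℕ) : ℂ)) - 1 = (zetaTail l : ℂ) := by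
  have h := zeta_nat_eq_tsum_of_gt_one (show 1 < 2 * (l + 1) by omega)
  have hs : Summable fun n : ℕ => 1 / (n : ℝ) ^ (2 * (l + 1)) :=
    Real.summable_one_div_nat_pow.2 (by omega)
  have h2 := hs.sum_add_tsum_nat_add 2
  rw [show (2 * ((l + 1 : ℕ) : ℂ)) = ((2 * (l + 1) : ℕ) : ℂ) by push_cast; ring, h]
  have h3 : ∑' n : ℕ, 1 / (n : ℂ) ^ (2 * (l + 1)) =
      ((∑' n : ℕ, 1 / (n : ℝ) ^ (2 * (l + 1)) : ℝ) : ℂ) := by push_cast; rfl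
  rw [h3, ← h2, zetaTail]
  simp [Finset.sum_range_succ, mul_add]

theorem hasSum_cot_remainder {x : ℝ} (hx : x ∈ Set.Ioc (0 : ℝ) (1 / 2)) :
    HasSum (fun n : ℕ => 2 * x / (((n : ℝ) + 1) ^ 2 - x ^ 2))
      (1 / x - π * (cos (π * x) / sin (π * x))) := by
  have hmem : (x : ℂ) ∈ Complex.integerComplement := by
    rintro ⟨n, hn⟩
    have hn' : (n : ℝ) = x := by exact_mod_cast hn
    have h0 : (0 : ℝ) < n := hn' ▸ hx.1
    have h1 : (n : ℝ) < 1 := by rw [hn']; linarith [hx.2]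
    have h0' : (0 : ℤ) < n := by exact_mod_cast h0
    have h1' : n < (1 : ℤ) := by exact_mod_cast h1
    omega
  have hs := (summable_cotTerm hmem).hasSum
  have hc := cot_series_rep' hmem
  simp only [cotTerm] at hs
  rw [← hc] at hs
  have h := (Complex.hasSum_re hs).neg
  convert! h using 1
  · ext n
    have h1 : ((n : ℝ) + 1) - x ≠ 0 := by
      linarith [hx.2, (Nat.cast_nonneg n : (0 : ℝ) ≤ n)]
    have h2 : ((n : ℝ) + 1) + x ≠ 0 := by
      linarith [hx.1, (Nat.cast_nonneg n : (0 : ℝ) ≤ n)]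
    rw [show (1 / ((x : ℂ) - (n + 1)) + 1 / (x + (n + 1))) =
      ((1 / (x - (n + 1)) + 1 / (x + (n + 1)) : ℝ) : ℂ) by push_cast; ring, Complex.ofReal_re]
    have h3 : x - (n + 1) ≠ 0 := fun h => h1 (by linarith)
    have h4 : x + (n + 1) ≠ 0 := fun h => h2 (by linarith)
    have h5 : ((n : ℝ) + 1) ^ 2 - x ^ 2 ≠ 0 := by
      rw [sq_sub_sq]; exact mul_ne_zero h2 h1
    field_simp
    ring
  · rw [show (π * Complex.cot (π * x) - 1 / x : ℂ) =
      ((π * (cos (π * x) / sin (π * x)) - 1 / x : ℝ) : ℂ) by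
        rw [Complex.cot]; push_cast; ring, Complex.ofReal_re]
    ring

theorem hasSum_pow_mul_zetaTail {x : ℝ} (hx : x ∈ Set.Ioc (0 : ℝ) (1 / 2)) :
    HasSum (fun l : ℕ => x ^ (2 * l + 1) * zetaTail l)
      ((1 / x - π * (cos (π * x) / sin (π * x)) - 2 * x / (1 - x ^ 2)) / 2) := by
  have hx0 := hx.1
  have hcot : HasSum (fun n : ℕ => x / (((n : ℝ) + 2) ^ 2 - x ^ 2))
      ((1 / x - π * (cos (π * x) / sin (π * x)) - 2 * x / (1 - x ^ 2)) / 2) := by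
    have h := ((hasSum_nat_add_iff' 1).2 (hasSum_cot_remainder hx)).div_const 2
    convert! h using 1
    · ext n
      push_cast
      ring
    · simp
  have hgeo : ∀ n : ℕ, HasSum (fun l : ℕ => x ^ (2 * l + 1) * (1 / ((n : ℝ) + 2) ^ (2 * l + 2)))
      (x / (((n : ℝ) + 2) ^ 2 - x ^ 2)) := by
    intro n
    have hn : (0 : ℝ) < n + 2 := by positivity
    have hlt : x < n + 2 := by linarith [hx.2, (Nat.cast_nonneg n : (0 : ℝ) ≤ n)]
    have hne : ((n : ℝ) + 2) ^ 2 - x ^ 2 ≠ 0 := by nlinarith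
    have h1 : (x / (n + 2)) ^ 2 < 1 := by
      rw [div_pow, div_lt_one (by positivity)]
      nlinarith
    have := (hasSum_geometric_of_lt_one (sq_nonneg _) h1).mul_left (x / ((n : ℝ) + 2) ^ 2)
    convert! this using 1
    · ext l
      rw [← pow_mul, div_pow, pow_succ, pow_add]
      field_simp
    · have : 1 - (x / ((n : ℝ) + 2)) ^ 2 = (((n : ℝ) + 2) ^ 2 - x ^ 2) / (n + 2) ^ 2 := by
        field_simp
      rw [this]
      field_simp
  have hprod : Summable fun p : ℕ × ℕ =>
      x ^ (2 * p.2 + 1) * (1 / ((p.1 : ℝ) + 2) ^ (2 * p.2 + 2)) := by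
    rw [summable_prod_of_nonneg fun p => by positivity]
    refine ⟨fun n => (hgeo n).summable, ?_⟩
    simp only [fun n => (hgeo n).tsum_eq]
    exact hcot.summable
  have hval := hprod.hasSum.prod_fiberwise hgeo
  rw [hcot.unique hval]
  exact ((Equiv.prodComm ℕ ℕ).hasSum_iff.2 hprod.hasSum).prod_fiberwise
    fun l => (summable_zetaTail l).hasSum.mul_left _

theorem hasDerivAt_neg_log_sinc {x : ℝ} (hx : x ∈ Set.Ioc (0 : ℝ) (1 / 2)) :
    HasDerivAt (fun x => -log (sinc (π * x))) (1 / x - π * (cos (π * x) / sin (π * x))) x := by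
  have hs := (sin_pi_mul_pos hx).ne'
  have hx0 := hx.1.ne'
  have hm : HasDerivAt (fun x : ℝ => π * x) π x := by
    simpa using (hasDerivAt_id x).const_mul π
  have h := (((hasDerivAt_id x).log hx0).add_const (log π)).sub (hm.sin.log hs)
  refine (h.congr_of_eventuallyEq ?_).congr_deriv (by simp only [id]; ring)
  filter_upwards [eventually_gt_nhds hx.1, hm.sin.continuousAt.eventually_ne hs] with y hy hsy
  have hπy : π * y ≠ 0 := (mul_pos pi_pos hy).ne'
  simp only [Pi.sub_apply, id]
  rw [sinc_of_ne_zero hπy, log_div hsy hπy, log_mul pi_ne_zero hy.ne']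
  ring

theorem sinc_pi_mul_pos {x : ℝ} (hx : x ∈ Set.Icc (0 : ℝ) (1 / 2)) : 0 < sinc (π * x) := by
  rcases hx.1.eq_or_lt with rfl | h0
  · simp
  · rw [sinc_of_ne_zero (mul_pos pi_pos h0).ne']
    exact div_pos (sin_pi_mul_pos ⟨h0, hx.2⟩) (mul_pos pi_pos h0)

theorem continuousOn_neg_log_sinc :
    ContinuousOn (fun x => -log (sinc (π * x))) (Set.Icc (0 : ℝ) (1 / 2)) := by
  refine ContinuousOn.neg (ContinuousOn.log ?_ fun x hx => (sinc_pi_mul_pos hx).ne')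
  exact (continuous_sinc.comp (continuous_const.mul continuous_id)).continuousOn

theorem intervalIntegrable_cot_remainder :
    IntervalIntegrable (fun x : ℝ => 1 / x - π * (cos (π * x) / sin (π * x))) volume 0 (1 / 2) := by
  have h : (0 : ℝ) ≤ 1 / 2 := by norm_num
  refine intervalIntegral.intervalIntegrable_deriv_of_nonneg
    (g := fun x => -log (sinc (π * x))) ?_ ?_ ?_
  · rw [Set.uIcc_of_le h]
    exact continuousOn_neg_log_sinc
  · rw [min_eq_left h, max_eq_right h]
    exact fun x hx => hasDerivAt_neg_log_sinc (Set.Ioo_subset_Ioc_self hx)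
  · rw [min_eq_left h, max_eq_right h]
    refine fun x hx => (hasSum_cot_remainder (Set.Ioo_subset_Ioc_self hx)).nonneg fun n => ?_
    refine div_nonneg (by linarith [hx.1]) ?_
    nlinarith [hx.1, hx.2, (Nat.cast_nonneg n : (0 : ℝ) ≤ n)]

theorem integral_cot_remainder :
    ∫ x in (0 : ℝ)..(1 / 2), (1 / x - π * (cos (π * x) / sin (π * x))) = log (π / 2) := by
  rw [intervalIntegral.integral_eq_sub_of_hasDerivAt_of_le (by norm_num) continuousOn_neg_log_sinc
    (fun x hx => hasDerivAt_neg_log_sinc (Set.Ioo_subset_Ioc_self hx))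
    intervalIntegrable_cot_remainder, sinc_of_ne_zero (by positivity), mul_one_div, sin_pi_div_two,
    ← log_inv]
  simp

theorem integral_weighted_remainder :
    ∫ x in (0 : ℝ)..(1 / 2), (1 - 2 * x) ^ 3 *
      (1 / x - π * (cos (π * x) / sin (π * x)) - 2 * x / (1 - x ^ 2)) =
      log (2 * π) + 27 * log (3 / 2) - 27 / 2 +
        6 / π ^ 2 * ∑' n : ℕ, 1 / ((n : ℝ) + 1) ^ 3 := by
  have hpoly : IntervalIntegrable (fun x : ℝ => 6 - 12 * x + 8 * x ^ 2) volume 0 (1 / 2) :=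
    Continuous.intervalIntegrable (by fun_prop) _ _
  have helem : IntervalIntegrable (fun x : ℝ => (1 - 2 * x) ^ 3 * (2 * x / (1 - x ^ 2)))
      volume 0 (1 / 2) := by
    refine ContinuousOn.intervalIntegrable ?_
    refine ContinuousOn.mul (by fun_prop) (ContinuousOn.div (by fun_prop) (by fun_prop) ?_)
    intro x hx
    rw [Set.uIcc_of_le (by norm_num)] at hx
    nlinarith [hx.1, hx.2]
  have hpolyI : ∫ x in (0 : ℝ)..(1 / 2), (6 - 12 * x + 8 * x ^ 2) = 11 / 6 := by
    have hd : ∀ x : ℝ, HasDerivAt (fun x : ℝ => 6 * x - 6 * x ^ 2 + 8 / 3 * x ^ 3)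
        (6 - 12 * x + 8 * x ^ 2) x := by
      intro x
      have := (((hasDerivAt_id x).const_mul 6).sub ((hasDerivAt_pow 2 x).const_mul 6)).add
        ((hasDerivAt_pow 3 x).const_mul (8 / 3))
      convert! this using 1
      norm_num
      ring
    rw [intervalIntegral.integral_eq_sub_of_hasDerivAt (fun x _ => hd x) hpoly]
    norm_num
  have heq : ∫ x in (0 : ℝ)..(1 / 2), (1 - 2 * x) ^ 3 *
      (1 / x - π * (cos (π * x) / sin (π * x)) - 2 * x / (1 - x ^ 2)) =
      ∫ x in (0 : ℝ)..(1 / 2), ((1 / x - π * (cos (π * x) / sin (π * x))) -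
        (6 - 12 * x + 8 * x ^ 2) +
        (1 - (1 - 2 * x) ^ 3) * (π * (cos (π * x) / sin (π * x))) -
        (1 - 2 * x) ^ 3 * (2 * x / (1 - x ^ 2))) := by
    refine intervalIntegral.integral_congr_ae (Eventually.of_forall fun x hx => ?_)
    rw [Set.uIoc_of_le (by norm_num)] at hx
    have hx0 : x ≠ 0 := hx.1.ne'
    have : (6 - 12 * x + 8 * x ^ 2) = (1 - (1 - 2 * x) ^ 3) * (1 / x) := by
      field_simp
      ring
    rw [this]
    ring
  rw [heq, intervalIntegral.integral_sub ((intervalIntegrable_cot_remainder.sub hpoly).add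
      intervalIntegrable_cubic_mul_cot) helem,
    intervalIntegral.integral_add (intervalIntegrable_cot_remainder.sub hpoly)
      intervalIntegrable_cubic_mul_cot,
    intervalIntegral.integral_sub intervalIntegrable_cot_remainder hpoly,
    integral_cot_remainder, hpolyI, integral_cubic_mul_cot, integral_elementary_part,
    log_div pi_ne_zero two_ne_zero, log_mul two_ne_zero pi_ne_zero]
  ring

theorem hasSum_coeff_mul_zetaTail :
    HasSum (fun l : ℕ => C (l + 1) * zetaTail l)
      (1 / 48 * (log (2 * π) + 27 * log (3 / 2) - 27 / 2 +
        6 / π ^ 2 * ∑' n : ℕ, 1 / ((n : ℝ) + 1) ^ 3)) := by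
  have h := intervalIntegral.hasSum_integral_of_dominated_convergence (μ := volume)
    (a := 0) (b := 1 / 2)
    (F := fun (l : ℕ) (x : ℝ) => 1 / 24 * (1 - 2 * x) ^ 3 * x ^ (2 * l + 1) * zetaTail l)
    (f := fun x => 1 / 48 * ((1 - 2 * x) ^ 3 *
      (1 / x - π * (cos (π * x) / sin (π * x)) - 2 * x / (1 - x ^ 2))))
    (fun l _ => (1 / 4 : ℝ) ^ l * zetaTail 0) ?_ ?_ ?_ ?_ ?_
  · rw [intervalIntegral.integral_const_mul, integral_weighted_remainder] at h
    simpa only [intervalIntegral.integral_mul_const, ← coeff_eq_integral] using h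
  · exact fun l => Continuous.aestronglyMeasurable (by fun_prop)
  · refine fun l => Eventually.of_forall fun x hx => ?_
    rw [Set.uIoc_of_le (by norm_num)] at hx
    have h0 : 0 ≤ 1 - 2 * x := by linarith [hx.2]
    have hx0 := hx.1
    rw [norm_of_nonneg (mul_nonneg (by positivity) (zetaTail_nonneg l))]
    refine mul_le_mul ?_ (zetaTail_le l) (zetaTail_nonneg l) (by positivity)
    have h1 : (1 - 2 * x) ^ 3 ≤ 1 := pow_le_one₀ h0 (by linarith)
    have h2 : x ^ (2 * l + 1) ≤ (1 / 4) ^ l := by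
      rw [pow_succ, pow_mul]
      have : (x ^ 2) ^ l ≤ (1 / 4) ^ l := pow_le_pow_left₀ (by positivity) (by nlinarith [hx.2]) l
      nlinarith [hx.2, pow_nonneg (sq_nonneg x) l]
    calc 1 / 24 * (1 - 2 * x) ^ 3 * x ^ (2 * l + 1)
        ≤ 1 * x ^ (2 * l + 1) := by gcongr; linarith
      _ ≤ (1 / 4) ^ l := by rw [one_mul]; exact h2
  · exact Eventually.of_forall fun _ _ =>
      (summable_geometric_of_lt_one (by norm_num) (by norm_num)).mul_right _
  · exact intervalIntegrable_const
  · refine Eventually.of_forall fun x hx => ?_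
    rw [Set.uIoc_of_le (by norm_num)] at hx
    have := (hasSum_pow_mul_zetaTail hx).mul_left (1 / 24 * (1 - 2 * x) ^ 3)
    convert! this using 1
    · ext l
      ring
    · ring

theorem riemannZeta_three_eq_tsum :
    riemannZeta 3 = ((∑' n : ℕ, 1 / ((n : ℝ) + 1) ^ 3 : ℝ) : ℂ) := by
  have h := zeta_nat_eq_tsum_of_gt_one (show 1 < 3 by norm_num)
  have hs : Summable fun n : ℕ => 1 / (n : ℝ) ^ 3 := Real.summable_one_div_nat_pow.2 (by norm_num)
  have h2 := hs.tsum_eq_zero_add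
  rw [show (riemannZeta 3) = riemannZeta ((3 : ℕ) : ℂ) by norm_num, h,
    show ∑' n : ℕ, 1 / (n : ℂ) ^ 3 = ((∑' n : ℕ, 1 / (n : ℝ) ^ 3 : ℝ) : ℂ) by push_cast; rfl, h2]
  simp

theorem zeta_three_series :
    riemannZeta 3 =
      -8 * (π : ℂ) ^ 2 *
        (((1 / 16 * (Real.log (2 * π) / 3 + 9 * Real.log (3 / 2) - 9 / 2) : ℝ) : ℂ) -
          ∑' l : ℕ+, (C l : ℂ) * (riemannZeta (2 * (l : ℕ)) - 1)) := by
  have hsum : ∑' l : ℕ+, (C l : ℂ) * (riemannZeta (2 * (l : ℕ)) - 1) =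
      ((∑' l : ℕ, C (l + 1) * zetaTail l : ℝ) : ℂ) := by
    rw [tsum_pnat_eq_tsum_succ (f := fun l : ℕ => (C l : ℂ) * (riemannZeta (2 * (l : ℂ)) - 1)),
      Complex.ofReal_tsum]
    refine tsum_congr fun l => ?_
    rw [riemannZeta_even_sub_one, Complex.ofReal_mul]
  rw [hsum, hasSum_coeff_mul_zetaTail.tsum_eq, riemannZeta_three_eq_tsum]
  have hπ : (π : ℂ) ≠ 0 := Complex.ofReal_ne_zero.2 pi_ne_zero
  generalize ∑' n : ℕ, 1 / ((n : ℝ) + 1) ^ 3 = z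
  generalize Real.log (2 * π) = a
  generalize Real.log (3 / 2) = b
  push_cast
  field_simp
  ring
end

section
/- ∑_{l=1}^∞ ζ(2l) / ((2l+1)·4^l) = (1 - ln 2)/2. -/
open Real

open Filter Topology

/-- The expansion of `n * log ((2 * n + 1) / (2 * n - 1)) - 1`, shifted to start at `n = 0`. -/
lemma hasSum_inv_odd_mul_inv_even_pow (n : ℕ) :
    HasSum (fun l : ℕ => 1 / (2 * ((l : ℝ) + 1) + 1) * (1 / (2 * ((n : ℝ) + 1))) ^ (2 * (l + 1)))
      (((n : ℝ) + 1) * (log (2 * n + 3) - log (2 * n + 1)) - 1) := by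
  have hn : (n : ℝ) + 1 ≠ 0 := by positivity
  have h := (hasSum_log_one_add_inv (a := (n : ℝ) + 1 / 2) (by positivity)).mul_left ((n : ℝ) + 1)
  rw [← hasSum_nat_add_iff' 1] at h
  have hlog : log (1 + ((n : ℝ) + 1 / 2)⁻¹) = log (2 * n + 3) - log (2 * n + 1) := by
    rw [← log_div (by positivity) (by positivity)]
    congr 1
    field_simp
    ring
  have hden : 2 * ((n : ℝ) + 1 / 2) + 1 = 2 * (n + 1) := by ring
  rw [hlog, hden] at h
  convert! h using 1
  · funext l
    push_cast
    rw [pow_succ _ (2 * (l + 1))]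
    field_simp
  · simp
    field_simp

lemma sum_range_mul_log_odd_sub (N : ℕ) :
    ∑ n ∈ Finset.range N, (((n : ℝ) + 1) * (log (2 * n + 3) - log (2 * n + 1)) - 1) =
      N * log (2 * N + 1) - N - (log (2 * N).factorial - log N.factorial - N * log 2) := by
  induction N with
  | zero => simp
  | succ N ih =>
    rw [Finset.sum_range_succ, ih, show 2 * (N + 1) = 2 * N + 1 + 1 by ring,
      Nat.factorial_succ (2 * N + 1), Nat.factorial_succ (2 * N), Nat.factorial_succ N]
    push_cast
    have hF : ((2 * N).factorial : ℝ) ≠ 0 := by positivity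
    have hG : (N.factorial : ℝ) ≠ 0 := by positivity
    rw [log_mul (by positivity) (by positivity), log_mul (by positivity) hF,
      log_mul (by positivity) hG, show (2 * (N : ℝ) + 1 + 1) = 2 * (N + 1) by ring,
      log_mul (by norm_num) (by positivity), show (2 * ((N : ℝ) + 1) + 1) = 2 * N + 3 by ring]
    ring

lemma sum_range_mul_log_odd_sub_eq_stirling {N : ℕ} (hN : N ≠ 0) :
    ∑ n ∈ Finset.range N, (((n : ℝ) + 1) * (log (2 * n + 3) - log (2 * n + 1)) - 1) =
      N * log (1 + (1 / 2) / N) -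
        (log (Stirling.stirlingSeq (2 * N)) - log (Stirling.stirlingSeq N)) - log 2 / 2 := by
  have hN' : (N : ℝ) ≠ 0 := by positivity
  have hlog : log (1 + (1 / 2) / (N : ℝ)) = log (2 * N + 1) - log 2 - log N := by
    rw [sub_sub, ← log_mul (by norm_num) hN', ← log_div (by positivity) (by positivity)]
    congr 1
    field_simp
  rw [sum_range_mul_log_odd_sub, hlog, Stirling.log_stirlingSeq_formula,
    Stirling.log_stirlingSeq_formula]
  push_cast
  rw [log_div (by positivity) (by positivity), log_div (by positivity) (by positivity),
    log_mul two_ne_zero (by positivity), log_mul two_ne_zero hN', log_exp]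
  ring

lemma hasSum_mul_log_odd_sub :
    HasSum (fun n : ℕ => ((n : ℝ) + 1) * (log (2 * n + 3) - log (2 * n + 1)) - 1)
      ((1 - log 2) / 2) := by
  rw [hasSum_iff_tendsto_nat_of_nonneg fun n =>
    (hasSum_inv_odd_mul_inv_even_pow n).nonneg fun l => by positivity]
  have hs : Tendsto (fun N => log (Stirling.stirlingSeq N)) atTop (𝓝 (log √π)) :=
    Stirling.tendsto_stirlingSeq_sqrt_pi.log (by positivity)
  have hs2 := hs.comp (tendsto_id.const_mul_atTop' (α := ℕ) two_pos)
  have hl := (tendsto_mul_log_one_add_div_atTop (1 / 2)).comp tendsto_natCast_atTop_atTop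
  have h := (hl.sub (hs2.sub hs)).sub_const (log 2 / 2)
  rw [show (1 - log 2) / 2 = 1 / 2 - (log √π - log √π) - log 2 / 2 by ring]
  refine h.congr' ?_
  filter_upwards [eventually_ne_atTop 0] with N hN
  exact (sum_range_mul_log_odd_sub_eq_stirling hN).symm

lemma riemannZeta_even_div_odd_four_pow (l : ℕ) :
    riemannZeta (2 * ((l + 1 : ℕ) : ℂ)) / ((2 * ((l + 1 : ℕ) : ℂ) + 1) * 4 ^ (l + 1)) =
      ((∑' n : ℕ, 1 / (2 * ((l : ℝ) + 1) + 1) *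
        (1 / (2 * ((n : ℝ) + 1))) ^ (2 * (l + 1)) : ℝ) : ℂ) := by
  have hz := zeta_nat_eq_tsum_of_gt_one (k := 2 * (l + 1)) (by omega)
  have hsum : Summable fun n : ℕ => 1 / (n : ℂ) ^ (2 * (l + 1)) := by
    simpa using Complex.ofRealCLM.summable
      (Real.summable_one_div_nat_pow.2 (show 1 < 2 * (l + 1) by omega))
  rw [hsum.tsum_eq_zero_add] at hz
  push_cast at hz ⊢
  rw [hz, tsum_mul_left, mul_comm, ← div_div, div_eq_mul_inv, div_eq_mul_inv]
  simp only [one_div, mul_inv, mul_pow, tsum_mul_left]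
  have h4 : (4 : ℂ) = 2 ^ 2 := by norm_num
  simp only [h4, ← pow_mul]
  simp
  ring

theorem tsum_zeta_even_div_odd_four_pow :
    ∑' l : ℕ+, riemannZeta (2 * (l : ℕ)) / ((2 * (l : ℕ) + 1) * 4 ^ (l : ℕ)) =
      (((1 - Real.log 2) / 2 : ℝ) : ℂ) := by
  rw [tsum_pnat_eq_tsum_succ
    (f := fun l : ℕ => riemannZeta (2 * (l : ℂ)) / ((2 * (l : ℂ) + 1) * 4 ^ l))]
  simp only [riemannZeta_even_div_odd_four_pow]
  rw [← Complex.ofReal_tsum, Summable.tsum_comm]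
  · simp only [(hasSum_inv_odd_mul_inv_even_pow _).tsum_eq]
    rw [hasSum_mul_log_odd_sub.tsum_eq]
  · rw [summable_prod_of_nonneg fun p => by
      simp only [Function.uncurry, Pi.zero_apply]
      positivity]
    refine ⟨fun n => (hasSum_inv_odd_mul_inv_even_pow n).summable, ?_⟩
    refine hasSum_mul_log_odd_sub.summable.congr fun n => ?_
    exact (hasSum_inv_odd_mul_inv_even_pow n).tsum_eq.symm
end

section
/- ∑_{l=1}^∞ (ζ(2l) - 1) / (l·4^l) = ln(π/2) - ln(4/3) (equivalently, = ln(3π/8)). -/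
open Real

open Filter Topology Finset

theorem hasSum_one_div_nat_add_two_pow {k : ℕ} (hk : 1 < k) :
    HasSum (fun n : ℕ => 1 / ((n : ℂ) + 2) ^ k) (riemannZeta k - 1) := by
  have hs : Summable (fun n : ℕ => 1 / (n : ℂ) ^ k) := by
    refine Summable.of_norm ?_
    simpa using Real.summable_one_div_nat_pow.2 hk
  have h := hs.hasSum
  rw [← zeta_nat_eq_tsum_of_gt_one hk] at h
  have h2 := (hasSum_nat_add_iff' 2).2 h
  have hk0 : k ≠ 0 := by omega
  simpa [sum_range_succ, hk0] using h2

/-- The logarithm of the Wallis product for `π / 2`, with its first factor removed. -/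
theorem hasSum_neg_log_one_sub_one_div_even_sq :
    HasSum (fun n : ℕ => -log (1 - 1 / (4 * ((n : ℝ) + 2) ^ 2)))
      (log (π / 2) - log (4 / 3)) := by
  have hterm (n : ℕ) : -log (1 - 1 / (4 * ((n : ℝ) + 2) ^ 2)) =
      log ((2 * ((n + 1 : ℕ) : ℝ) + 2) / (2 * ((n + 1 : ℕ) : ℝ) + 1) *
        ((2 * ((n + 1 : ℕ) : ℝ) + 2) / (2 * ((n + 1 : ℕ) : ℝ) + 3))) := by
    rw [← log_inv]
    congr 1
    rw [inv_eq_iff_eq_inv]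
    push_cast
    field_simp
    ring
  have hnonneg (n : ℕ) : 0 ≤ -log (1 - 1 / (4 * ((n : ℝ) + 2) ^ 2)) := by
    have h1 : 1 / (4 * ((n : ℝ) + 2) ^ 2) ≤ 1 := by
      rw [div_le_one (by positivity)]
      nlinarith [(Nat.cast_nonneg n : (0 : ℝ) ≤ n)]
    have h0 : 0 ≤ 1 / (4 * ((n : ℝ) + 2) ^ 2) := by positivity
    exact neg_nonneg.2 (log_nonpos (by linarith) (by linarith))
  rw [hasSum_iff_tendsto_nat_of_nonneg hnonneg]
  have hlim := ((Real.tendsto_prod_pi_div_two.log (by positivity)).comp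
    (tendsto_add_atTop_nat 1)).sub_const (log (4 / 3))
  refine hlim.congr fun N => ?_
  rw [Function.comp_apply, log_prod (fun i _ => by positivity), sum_range_succ']
  simp_rw [hterm]
  norm_num

/-- The double series obtained by expanding the logarithms of the Wallis factors. -/
theorem hasSum_prod_one_div_even_sq_pow_div :
    HasSum (fun p : ℕ × ℕ => (1 / (4 * ((p.1 : ℝ) + 2) ^ 2)) ^ (p.2 + 1) / ((p.2 : ℝ) + 1))
      (log (π / 2) - log (4 / 3)) := by
  have hrow (n : ℕ) : HasSum
      (fun l : ℕ => (1 / (4 * ((n : ℝ) + 2) ^ 2)) ^ (l + 1) / ((l : ℝ) + 1))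
      (-log (1 - 1 / (4 * ((n : ℝ) + 2) ^ 2))) := by
    refine hasSum_pow_div_log_of_abs_lt_one ?_
    rw [abs_of_nonneg (by positivity), div_lt_one (by positivity)]
    nlinarith [(Nat.cast_nonneg n : (0 : ℝ) ≤ n)]
  have hs : Summable fun p : ℕ × ℕ =>
      (1 / (4 * ((p.1 : ℝ) + 2) ^ 2)) ^ (p.2 + 1) / ((p.2 : ℝ) + 1) := by
    refine (summable_prod_of_nonneg fun p => by positivity).2 ⟨fun n => (hrow n).summable, ?_⟩
    simp_rw [fun n => (hrow n).tsum_eq]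
    exact hasSum_neg_log_one_sub_one_div_even_sq.summable
  have h := hs.hasSum
  rwa [(h.prod_fiberwise hrow).unique hasSum_neg_log_one_sub_one_div_even_sq] at h

theorem tsum_zeta_even_sub_one_div_l_four_pow :
    ∑' l : ℕ+, (riemannZeta (2 * (l : ℕ)) - 1) / ((l : ℕ) * 4 ^ (l : ℕ)) =
      ((Real.log (π / 2) - Real.log (4 / 3) : ℝ) : ℂ) := by
  rw [tsum_pnat_eq_tsum_succ
    (f := fun l : ℕ => (riemannZeta (2 * (l : ℂ)) - 1) / ((l : ℂ) * 4 ^ l))]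
  have h := (Equiv.prodComm ℕ ℕ).hasSum_iff.2
    (Complex.hasSum_ofReal.2 hasSum_prod_one_div_even_sq_pow_div)
  refine (h.prod_fiberwise fun l => ?_).tsum_eq
  have hl := (hasSum_one_div_nat_add_two_pow (k := 2 * (l + 1)) (by omega)).div_const
    (((l + 1 : ℕ) : ℂ) * 4 ^ (l + 1))
  rw [Nat.cast_mul, Nat.cast_ofNat] at hl
  refine hl.congr_fun fun n => ?_
  simp only [Function.comp_apply, Equiv.prodComm_apply, Prod.swap_prod_mk]
  push_cast
  rw [pow_mul, div_pow, mul_pow, one_pow, div_div, div_div]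
  ring
end

section
/- ∑_{l=1}^∞ (ζ(2l) - 1) / ((2l+1)·4^l) = 3/2 - ln(3·√2). -/
open Real

/-- The expansion `artanh x / x - 1 = ∑_{j ≥ 1} x ^ (2 j) / (2 j + 1)` at `x = 1 / (2 n)`. -/
lemma hasSum_one_div_two_mul_pow_div_odd {n : ℕ} (hn : 0 < n) :
    HasSum (fun j : ℕ ↦ (1 / (2 * (n : ℝ))) ^ (2 * (j + 1)) / (2 * ((j + 1 : ℕ) : ℝ) + 1))
      (n * (log (2 * n + 1) - log (2 * n - 1)) - 1) := by
  have hn1 : (1 : ℝ) ≤ n := by exact_mod_cast hn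
  have hx : |1 / (2 * (n : ℝ))| < 1 := by
    rw [abs_of_pos (by positivity), div_lt_one (by positivity)]
    linarith
  have h := (hasSum_log_sub_log_of_abs_lt_one hx).mul_left (n : ℝ)
  rw [← hasSum_nat_add_iff' 1] at h
  convert h using 1 <;> try rfl
  · funext j
    have h2 : (2 * ((j + 1 : ℕ) : ℝ) + 1) ≠ 0 := by positivity
    rw [pow_succ _ (2 * (j + 1))]
    field_simp
  · have hadd : 1 + 1 / (2 * (n : ℝ)) = (2 * n + 1) / (2 * n) := by field_simp
    have hsub : 1 - 1 / (2 * (n : ℝ)) = (2 * n - 1) / (2 * n) := by field_simp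
    rw [hadd, hsub, log_div (by positivity) (by positivity),
      log_div (by linarith) (by positivity)]
    simp
    field_simp

lemma sum_range_mul_log_odd_sub_log_odd (M : ℕ) :
    ∑ k ∈ Finset.range M, (((k + 2 : ℕ) : ℝ) *
      (log (2 * ((k + 2 : ℕ) : ℝ) + 1) - log (2 * ((k + 2 : ℕ) : ℝ) - 1)) - 1) =
    (M + 1) * log (2 * M + 3) - log 3 - log ((2 * (M + 1)).factorial) + (M + 1) * log 2
      + log ((M + 1).factorial) - M := by
  induction M with
  | zero => simp
  | succ M ih =>
    rw [Finset.sum_range_succ, ih, show 2 * (M + 1 + 1) = 2 * (M + 1) + 1 + 1 by ring,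
      Nat.factorial_succ (2 * (M + 1) + 1), Nat.factorial_succ (2 * (M + 1)),
      Nat.factorial_succ (M + 1)]
    push_cast
    rw [log_mul (by positivity) (by positivity), log_mul (by positivity) (by positivity),
      log_mul (by positivity) (by positivity),
      show (2 * ((M : ℝ) + 1) + 1 + 1) = 2 * (M + 1 + 1) by ring,
      log_mul (by positivity) (by positivity),
      show (2 * ((M : ℝ) + 2) + 1) = 2 * (M + 1) + 3 by ring,
      show (2 * ((M : ℝ) + 2) - 1) = 2 * M + 3 by ring,
      show (2 * ((M : ℝ) + 1) + 1) = 2 * M + 3 by ring]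
    ring

lemma sum_range_mul_log_odd_sub_log_odd_eq_stirlingSeq (M : ℕ) :
    ∑ k ∈ Finset.range M, (((k + 2 : ℕ) : ℝ) *
      (log (2 * ((k + 2 : ℕ) : ℝ) + 1) - log (2 * ((k + 2 : ℕ) : ℝ) - 1)) - 1) =
    ((M + 1 : ℕ) : ℝ) * log (1 + (1 / 2) / ((M + 1 : ℕ) : ℝ)) + 1 - log (3 * √2)
      - (log (Stirling.stirlingSeq (2 * (M + 1))) - log (Stirling.stirlingSeq (M + 1))) := by
  rw [sum_range_mul_log_odd_sub_log_odd, Stirling.log_stirlingSeq_formula,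
    Stirling.log_stirlingSeq_formula]
  push_cast
  have h : 1 + 1 / 2 / ((M : ℝ) + 1) = (2 * M + 3) / (2 * (M + 1)) := by
    field_simp
    ring
  rw [h, log_div (by positivity) (by positivity), log_div (by positivity) (by positivity),
    log_div (by positivity) (by positivity), log_mul (by positivity) (by positivity),
    log_mul (by positivity) (by positivity), log_mul (by positivity) (by positivity),
    log_mul (by positivity) (by positivity), log_sqrt (by positivity), log_exp]
  ring

lemma hasSum_mul_log_odd_sub_log_odd :
    HasSum (fun k : ℕ ↦ ((k + 2 : ℕ) : ℝ) *
      (log (2 * ((k + 2 : ℕ) : ℝ) + 1) - log (2 * ((k + 2 : ℕ) : ℝ) - 1)) - 1)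
      (3 / 2 - log (3 * √2)) := by
  rw [hasSum_iff_tendsto_nat_of_nonneg fun k ↦
    (hasSum_one_div_two_mul_pow_div_odd (Nat.succ_pos (k + 1))).nonneg fun j ↦ by positivity]
  simp_rw [sum_range_mul_log_odd_sub_log_odd_eq_stirlingSeq]
  have hsucc : Filter.Tendsto (fun M : ℕ ↦ M + 1) Filter.atTop Filter.atTop :=
    Filter.tendsto_add_atTop_nat 1
  have hdouble : Filter.Tendsto (fun M : ℕ ↦ 2 * (M + 1)) Filter.atTop Filter.atTop :=
    Filter.tendsto_atTop_mono (fun M ↦ by omega) hsucc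
  have hlog := Stirling.tendsto_stirlingSeq_sqrt_pi.log (by positivity)
  have h := (((((tendsto_mul_log_one_add_div_atTop (1 / 2)).comp
    tendsto_natCast_atTop_atTop).comp hsucc).add_const 1).sub_const (log (3 * √2))).sub
    ((hlog.comp hdouble).sub (hlog.comp hsucc))
  have hlim : 3 / 2 - log (3 * √2) = 1 / 2 + 1 - log (3 * √2) - (log √π - log √π) := by ring
  rw [hlim]
  exact h

lemma riemannZeta_nat_sub_one_eq_tsum {m : ℕ} (hm : 1 < m) :
    riemannZeta m - 1 = ((∑' k : ℕ, 1 / ((k + 2 : ℕ) : ℝ) ^ m : ℝ) : ℂ) := by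
  have h := (summable_one_div_nat_pow.mpr hm).sum_add_tsum_nat_add 2
  have hz : riemannZeta m = ((∑' n : ℕ, 1 / (n : ℝ) ^ m : ℝ) : ℂ) := by
    rw [zeta_nat_eq_tsum_of_gt_one hm]
    push_cast
    rfl
  rw [hz, ← h]
  simp [Finset.sum_range_succ, show m ≠ 0 by omega]

theorem tsum_zeta_even_sub_one_div_odd_four_pow :
    ∑' l : ℕ+, (riemannZeta (2 * (l : ℕ)) - 1) / ((2 * (l : ℕ) + 1) * 4 ^ (l : ℕ)) =
      ((3 / 2 - Real.log (3 * Real.sqrt 2) : ℝ) : ℂ) := by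
  rw [tsum_pnat_eq_tsum_succ
    (f := fun l : ℕ ↦ (riemannZeta (2 * l) - 1) / ((2 * (l : ℂ) + 1) * 4 ^ l))]
  let f : ℕ → ℕ → ℝ := fun k j ↦
    (1 / (2 * ((k + 2 : ℕ) : ℝ))) ^ (2 * (j + 1)) / (2 * ((j + 1 : ℕ) : ℝ) + 1)
  have hf (k : ℕ) : HasSum (f k) _ := hasSum_one_div_two_mul_pow_div_odd (Nat.succ_pos (k + 1))
  have hsum : Summable (Function.uncurry f) := by
    refine (summable_prod_of_nonneg fun p ↦ ?_).mpr ⟨fun k ↦ (hf k).summable, ?_⟩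
    · simp only [Function.uncurry, f, Pi.zero_apply]
      positivity
    · exact hasSum_mul_log_odd_sub_log_odd.summable.congr fun k ↦ (hf k).tsum_eq.symm
  have hval : ∑' k, ∑' j, f k j = 3 / 2 - log (3 * √2) := by
    rw [← hasSum_mul_log_odd_sub_log_odd.tsum_eq]
    exact tsum_congr fun k ↦ (hf k).tsum_eq
  rw [← hval, ← hsum.tsum_comm, Complex.ofReal_tsum]
  refine tsum_congr fun j ↦ ?_
  have hfj (k : ℕ) : f k j = 1 / ((k + 2 : ℕ) : ℝ) ^ (2 * (j + 1)) *
      (1 / ((2 * ((j + 1 : ℕ) : ℝ) + 1) * 4 ^ (j + 1))) := by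
    simp only [f]
    rw [div_pow, mul_pow, pow_mul 2 2, one_pow]
    norm_num
    field_simp
  simp_rw [hfj]
  rw [tsum_mul_right, Complex.ofReal_mul, ← riemannZeta_nat_sub_one_eq_tsum (by omega)]
  push_cast
  ring
end

section
/- ∑_{l=1}^∞ (ζ(2l) - 1) / ((2l+3)·4^l) = ∑_{n=2}^∞ ( 4n³ · ln((2n+1)/(2n-1)) - 4n² - 1/3 ). -/
open Real

theorem hasSum_one_div_mul_four_pow_log {x : ℝ} (hx : 1 < x) :
    HasSum (fun j : ℕ => 1 / ((2 * (j : ℝ) + 5) * 4 ^ (j + 1)) * (1 / x ^ (2 * (j + 1))))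
      (4 * x ^ 3 * Real.log ((2 * x + 1) / (2 * x - 1)) - 4 * x ^ 2 - 1 / 3) := by
  have hx0 : 0 < x := by linarith
  have hlt : |1 / (2 * x)| < 1 := by
    rw [abs_of_pos (by positivity), div_lt_one (by positivity)]
    linarith
  have hlog : Real.log (1 + 1 / (2 * x)) - Real.log (1 - 1 / (2 * x)) =
      Real.log ((2 * x + 1) / (2 * x - 1)) := by
    rw [abs_lt] at hlt
    rw [← Real.log_div (by positivity) (by linarith)]
    have h : 2 * x - 1 ≠ 0 := by linarith
    congr 1
    field_simp
  have h := (hasSum_log_sub_log_of_abs_lt_one hlt).mul_left (4 * x ^ 3)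
  rw [hlog, ← hasSum_nat_add_iff' 2] at h
  convert! h using 1
  · funext j
    push_cast
    have : (2 * (j : ℝ) + 5) ≠ 0 := by positivity
    have h4 : (4 : ℝ) ^ (j + 1) = 2 ^ (2 * (j + 1)) := by rw [pow_mul]; norm_num
    rw [h4, show 2 * ((j : ℝ) + 2) + 1 = 2 * j + 5 by ring,
      show 2 * (j + 2) + 1 = 2 * (j + 1) + 3 by ring, div_pow, pow_add (2 * x), mul_pow 2 x, one_pow]
    field_simp
    norm_num
  · simp only [Finset.sum_range_succ, Finset.sum_range_zero]
    push_cast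
    field_simp
    ring

theorem summable_one_div_natCast_add_two_pow {k : ℕ} (hk : 1 < k) :
    Summable fun n : ℕ => 1 / ((n : ℝ) + 2) ^ k := by
  simpa using (summable_nat_add_iff 2).2 (Real.summable_one_div_nat_pow.2 hk)

theorem riemannZeta_natCast_sub_one {k : ℕ} (hk : 1 < k) :
    riemannZeta k - 1 = ((∑' n : ℕ, 1 / ((n : ℝ) + 2) ^ k : ℝ) : ℂ) := by
  rw [zeta_nat_eq_tsum_of_gt_one hk]
  have h : ∑' n : ℕ, 1 / (n : ℂ) ^ k = ((∑' n : ℕ, 1 / (n : ℝ) ^ k : ℝ) : ℂ) := by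
    push_cast
    rfl
  rw [h, ← (Real.summable_one_div_nat_pow.2 hk).sum_add_tsum_nat_add 2]
  have hk0 : k ≠ 0 := by omega
  simp [Finset.sum_range_succ, hk0]

theorem summable_zeta_even_double_series :
    Summable (Function.uncurry fun j n : ℕ =>
      1 / ((2 * (j : ℝ) + 5) * 4 ^ (j + 1)) * (1 / ((n : ℝ) + 2) ^ (2 * (j + 1)))) := by
  have hg : Summable fun j : ℕ => ((1 : ℝ) / 4) ^ j :=
    summable_geometric_of_lt_one (by norm_num) (by norm_num)
  refine (hg.mul_of_nonneg (summable_one_div_natCast_add_two_pow one_lt_two)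
    (fun _ => by positivity) (fun _ => by positivity)).of_nonneg_of_le ?_ ?_
  · rintro ⟨j, n⟩
    simp only [Function.uncurry]
    positivity
  · rintro ⟨j, n⟩
    simp only [Function.uncurry, div_pow, one_pow]
    have hn : (1 : ℝ) ≤ (n : ℝ) + 2 := by linarith [n.cast_nonneg (α := ℝ)]
    gcongr
    · rw [pow_succ]
      nlinarith [j.cast_nonneg (α := ℝ), pow_pos (four_pos (α := ℝ)) j,
        mul_nonneg (j.cast_nonneg (α := ℝ)) (pow_pos (four_pos (α := ℝ)) j).le]
    · omega

theorem tsum_zeta_even_sub_one_div_two_l_add_three_four_pow :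
    ∑' l : ℕ+, (riemannZeta (2 * (l : ℕ)) - 1) / ((2 * (l : ℕ) + 3) * 4 ^ (l : ℕ)) =
      ((∑' n : ℕ, (4 * ((n : ℝ) + 2) ^ 3 *
          Real.log ((2 * ((n : ℝ) + 2) + 1) / (2 * ((n : ℝ) + 2) - 1)) -
            4 * ((n : ℝ) + 2) ^ 2 - 1 / 3) : ℝ) : ℂ) := by
  rw [tsum_pnat_eq_tsum_succ (f := fun l : ℕ =>
    (riemannZeta (2 * (l : ℂ)) - 1) / ((2 * (l : ℂ) + 3) * 4 ^ l))]
  have hterm (n : ℕ) := (hasSum_one_div_mul_four_pow_log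
    (x := (n : ℝ) + 2) (by linarith [n.cast_nonneg (α := ℝ)])).tsum_eq
  simp only [← hterm]
  rw [summable_zeta_even_double_series.tsum_comm, Complex.ofReal_tsum]
  refine tsum_congr fun j => ?_
  have hz := riemannZeta_natCast_sub_one (k := 2 * (j + 1)) (by omega)
  rw [tsum_mul_left]
  push_cast at hz ⊢
  rw [hz]
  ring
end

section
/- For every positive integer l, the derivative of the Riemann zeta function at the even negative integer -2l satisfies ζ'(-2l) = (-1)^l · (2l)! · ζ(2l+1) / (2 · (2π)^{2l}). -/
open Real

theorem deriv_zeta_neg_even (l : ℕ) (hl : 1 ≤ l) :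
    deriv riemannZeta (-2 * (l : ℂ)) =
      (-1) ^ l * (Nat.factorial (2 * l) : ℂ) * riemannZeta (2 * l + 1) /
        (2 * (2 * (π : ℂ)) ^ (2 * l)) := by
  have hπ : (π : ℂ) ≠ 0 := Complex.ofReal_ne_zero.mpr pi_ne_zero
  have hl' : (1 : ℝ) ≤ l := by exact_mod_cast hl
  have hre : 1 < (2 * (l : ℂ) + 1).re := by
    simp
    linarith
  have avoids {s : ℂ} (hs : 1 < s.re) : (∀ n : ℕ, s ≠ -n) ∧ s ≠ 1 := by
    refine ⟨fun n h ↦ ?_, fun h ↦ ?_⟩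
    · rw [h] at hs
      simp at hs
      linarith [n.cast_nonneg (α := ℝ)]
    · simp [h] at hs
  set A : ℂ → ℂ := fun s ↦ 2 * (2 * π) ^ (-s) * Complex.Gamma s * riemannZeta s with hA
  have functional_eq : (fun s : ℂ ↦ riemannZeta (1 - s)) =ᶠ[nhds (2 * (l : ℂ) + 1)]
      fun s ↦ A s * Complex.cos (π * s / 2) := by
    filter_upwards [(isOpen_lt continuous_const Complex.continuous_re).mem_nhds hre] with s hs
    rw [riemannZeta_one_sub (avoids hs).1 (avoids hs).2]
    ring
  have hA_diff : DifferentiableAt ℂ A (2 * (l : ℂ) + 1) := by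
    have hpow : DifferentiableAt ℂ (fun s : ℂ ↦ (2 * (π : ℂ)) ^ (-s)) (2 * (l : ℂ) + 1) :=
      differentiableAt_id.neg.const_cpow (Or.inl (by simp [hπ]))
    exact ((hpow.const_mul 2).mul (Complex.differentiableAt_Gamma _ (avoids hre).1)).mul
      (differentiableAt_riemannZeta (avoids hre).2)
  have hangle : (π : ℂ) * (2 * l + 1) / 2 = π / 2 + l * π := by ring
  have hcos : Complex.cos (π * (2 * l + 1) / 2) = 0 := by
    rw [hangle, Complex.cos_antiperiodic.add_nat_mul_eq, Complex.cos_pi_div_two, mul_zero]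
  have hsin : Complex.sin (π * (2 * l + 1) / 2) = (-1) ^ l := by
    rw [hangle, Complex.sin_antiperiodic.add_nat_mul_eq, Complex.sin_pi_div_two, mul_one]
  have hcos_deriv : HasDerivAt (fun s : ℂ ↦ Complex.cos (π * s / 2))
      (-(-1) ^ l * (π / 2)) (2 * (l : ℂ) + 1) := by
    have h := (((hasDerivAt_id (2 * (l : ℂ) + 1)).const_mul (π : ℂ)).div_const 2).ccos
    simpa [hsin] using h
  have hderiv := functional_eq.deriv_eq
  rw [deriv_comp_const_sub, (hA_diff.hasDerivAt.fun_mul hcos_deriv).deriv, hcos, mul_zero,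
    zero_add, show (1 : ℂ) - (2 * l + 1) = -2 * l by ring] at hderiv
  have hGamma : Complex.Gamma (2 * l + 1) = (Nat.factorial (2 * l) : ℂ) := by
    exact_mod_cast Complex.Gamma_nat_eq_factorial (2 * l)
  have hpow : (2 * (π : ℂ)) ^ (-(2 * (l : ℂ) + 1)) = ((2 * (π : ℂ)) ^ (2 * l + 1))⁻¹ := by
    rw [Complex.cpow_neg, ← Complex.cpow_natCast]
    push_cast
    rfl
  rw [← neg_inj, hderiv]
  simp only [hA]
  rw [hGamma, hpow, pow_succ]
  field_simp
end

section
/- For every positive integer n, the function s ↦ Γ(s)·ζ(s) tends to ζ'(-2n)/(2n)! as s tends to -2n (along the punctured neighborhood of -2n in ℂ). In particular the simple pole of Γ at -2n is cancelled by the trivial zero of ζ at -2n. -/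
open Real Filter Topology

/-- The residue of the complex Gamma function at `-m` is `(-1) ^ m / m!`. -/
theorem tendsto_add_nat_mul_Gamma_nhds_neg_nat (m : ℕ) :
    Tendsto (fun s : ℂ => (s + m) * Complex.Gamma s) (𝓝[≠] (-(m : ℂ)))
      (𝓝 ((-1) ^ m / (m.factorial : ℂ))) := by
  induction m with
  | zero => simpa using Complex.tendsto_self_mul_Gamma_nhds_zero
  | succ m ih =>
    have h0 : -((m + 1 : ℕ) : ℂ) ≠ 0 := neg_ne_zero.mpr (Nat.cast_ne_zero.mpr m.succ_ne_zero)
    have hshift : Tendsto (fun s : ℂ => s + 1) (𝓝[≠] (-((m + 1 : ℕ) : ℂ))) (𝓝[≠] (-(m : ℂ))) := by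
      refine tendsto_nhdsWithin_iff.mpr ⟨?_, ?_⟩
      · have h : ContinuousAt (fun s : ℂ => s + 1) (-((m + 1 : ℕ) : ℂ)) := by fun_prop
        have h' := h.tendsto
        rw [show -((m + 1 : ℕ) : ℂ) + 1 = -(m : ℂ) by push_cast; ring] at h'
        exact h'.mono_left nhdsWithin_le_nhds
      · filter_upwards [self_mem_nhdsWithin] with s hs h
        refine hs (Set.mem_singleton_iff.mpr ?_)
        push_cast
        linear_combination Set.mem_singleton_iff.mp h
    have hid : Tendsto (fun s : ℂ => s) (𝓝[≠] (-((m + 1 : ℕ) : ℂ))) (𝓝 (-((m + 1 : ℕ) : ℂ))) :=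
      tendsto_id.mono_left nhdsWithin_le_nhds
    have hlim := (ih.comp hshift).div hid h0
    rw [show ((-1) ^ m / (m.factorial : ℂ)) / (-((m + 1 : ℕ) : ℂ)) =
        (-1) ^ (m + 1) / ((m + 1).factorial : ℂ) by
      rw [Nat.factorial_succ, Nat.cast_mul, div_div, pow_succ, mul_neg, div_neg, mul_comm (_ : ℂ)
        ((m + 1 : ℕ) : ℂ)]
      ring] at hlim
    refine hlim.congr' ?_
    filter_upwards [hid.eventually_ne h0] with s hs
    simp only [Pi.div_apply, Function.comp_apply, Complex.Gamma_add_one s hs]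
    push_cast
    field_simp
    ring

theorem tendsto_Gamma_mul_zeta_neg_even (n : ℕ) (hn : 1 ≤ n) :
    Filter.Tendsto (fun s : ℂ => Complex.Gamma s * riemannZeta s)
      (𝓝[≠] (-2 * (n : ℂ)))
      (𝓝 (deriv riemannZeta (-2 * (n : ℂ)) / (Nat.factorial (2 * n) : ℂ))) := by
  have hpt : -((2 * n : ℕ) : ℂ) = -2 * (n : ℂ) := by push_cast; ring
  have hGamma := tendsto_add_nat_mul_Gamma_nhds_neg_nat (2 * n)
  rw [hpt, (even_two_mul n).neg_one_pow] at hGamma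
  have hzero : riemannZeta (-2 * (n : ℂ)) = 0 := by
    obtain ⟨k, rfl⟩ := Nat.exists_eq_add_of_le' hn
    exact_mod_cast riemannZeta_neg_two_mul_nat_add_one k
  have hne : -2 * (n : ℂ) ≠ 1 := by
    rw [← hpt]
    intro h
    have h' := congrArg Complex.re h
    rw [Complex.neg_re, Complex.natCast_re, Complex.one_re] at h'
    linarith [(2 * n).cast_nonneg (α := ℝ)]
  have hslope := (differentiableAt_riemannZeta hne).hasDerivAt.tendsto_slope
  have hlim := hGamma.mul hslope
  rw [one_div_mul_eq_div] at hlim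
  refine hlim.congr' ?_
  filter_upwards [self_mem_nhdsWithin] with s hs
  have hs' : s - -2 * (n : ℂ) ≠ 0 := sub_ne_zero.mpr hs
  rw [slope_def_field, hzero, sub_zero,
    show s + ((2 * n : ℕ) : ℂ) = s - -2 * (n : ℂ) by push_cast; ring, mul_assoc, mul_left_comm,
    mul_div_cancel₀ _ hs']
end

section
/- The function s ↦ Γ(s)·ζ(s) tends to -ζ(3)/(8π²) as s tends to -2 (along the punctured neighborhood of -2 in ℂ). -/
open Real Filter Topology

theorem tendsto_Gamma_mul_zeta_neg_two :
    Filter.Tendsto (fun s : ℂ => Complex.Gamma s * riemannZeta s)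
      (𝓝[≠] (-2 : ℂ)) (𝓝 (-riemannZeta 3 / (8 * (π : ℂ) ^ 2))) := by
  have hpi : (2 * (π : ℂ)) ≠ 0 := by simp [Real.pi_ne_zero]
  have hcos : Complex.cos (π * (-2) / 2) = -1 := by
    rw [show (π : ℂ) * (-2) / 2 = -π by ring, Complex.cos_neg, Complex.cos_pi]
  have hpow : (2 * (π : ℂ)) ^ (-(-2 : ℂ)) = 4 * (π : ℂ) ^ 2 := by
    rw [neg_neg, Complex.cpow_ofNat]
    ring
  set d : ℂ → ℂ := fun s => 2 * (2 * (π : ℂ)) ^ (-s) * Complex.cos (π * s / 2) with hd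
  have hd_val : d (-2) = -(8 * (π : ℂ) ^ 2) := by
    simp only [hd, hcos, hpow]
    ring
  have hd_ne : d (-2) ≠ 0 := by simp [hd_val, Real.pi_ne_zero]
  have hd_cont : ContinuousAt d (-2) :=
    (continuousAt_const.mul (continuousAt_neg.const_cpow (Or.inl hpi))).mul (by fun_prop)
  have hzeta : ContinuousAt (fun s : ℂ => riemannZeta (1 - s)) (-2) :=
    ContinuousAt.comp (g := riemannZeta)
      (differentiableAt_riemannZeta (by norm_num)).continuousAt (by fun_prop)
  have hlim : Tendsto (fun s : ℂ => riemannZeta (1 - s) / d s) (𝓝[≠] (-2 : ℂ))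
      (𝓝 (-riemannZeta 3 / (8 * (π : ℂ) ^ 2))) := by
    have hval : -riemannZeta 3 / (8 * (π : ℂ) ^ 2) = riemannZeta (1 - (-2)) / d (-2) := by
      rw [hd_val, div_neg, neg_div]
      norm_num
    rw [hval]
    exact (hzeta.div hd_cont hd_ne).tendsto.mono_left nhdsWithin_le_nhds
  refine hlim.congr' ?_
  filter_upwards [nhdsWithin_le_nhds (Metric.ball_mem_nhds (-2 : ℂ) one_pos),
    nhdsWithin_le_nhds (hd_cont.eventually_ne hd_ne), self_mem_nhdsWithin] with s hball hds hs
  have hs_nat (n : ℕ) : s ≠ -n := by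
    rintro rfl
    have hlt : ‖((2 - n : ℤ) : ℂ)‖ < 1 := by
      rw [Metric.mem_ball, dist_eq_norm] at hball
      rw [show ((2 - n : ℤ) : ℂ) = -n - -2 by push_cast; ring]
      exact hball
    rw [Complex.norm_intCast] at hlt
    have habs : |(2 - n : ℤ)| < 1 := by exact_mod_cast hlt
    have hn : n = 2 := by
      have := Int.abs_lt_one_iff.mp habs
      omega
    exact hs (by simp [hn])
  have hs_one : s ≠ 1 := by
    rintro rfl
    rw [Metric.mem_ball, dist_eq_norm] at hball
    norm_num at hball
  rw [riemannZeta_one_sub hs_nat hs_one, div_eq_iff hds]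
  simp only [hd]
  ring
end

section
/- For every positive integer m, the tail of the series satisfies ∑_{l=m+1}^∞ C_l · (ζ(2l) - 1) < ( 1 + 2/(2m+1) ) · ∑_{l=m+1}^∞ 1 / (2^{4l+6} · l⁴), where C_l = 1 / (16 · 4^l · l(l+1)(2l+1)(2l+3)). -/
open Real

theorem riemannZeta_natCast_re {k : ℕ} (hk : 1 < k) :
    (riemannZeta k).re = ∑' n : ℕ, 1 / (n : ℝ) ^ k := by
  rw [zeta_nat_eq_tsum_of_gt_one hk, ← Complex.ofReal_re (∑' n : ℕ, 1 / (n : ℝ) ^ k)]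
  push_cast
  rfl

theorem one_div_pow_succ_le_sub {k : ℕ} (hk : 1 ≤ k) {x : ℝ} (hx : 0 < x) :
    1 / (x + 1) ^ (k + 1) ≤ 1 / k * (1 / x ^ k - 1 / (x + 1) ^ k) := by
  have hk' : (0 : ℝ) < k := by exact_mod_cast hk
  have bernoulli : 1 + k * (1 / x) ≤ (1 + 1 / x) ^ k :=
    one_add_mul_le_pow (by linarith [one_div_pos.2 hx]) k
  have hquot : (1 + 1 / x) ^ k = (x + 1) ^ k * (1 / x ^ k) := by
    rw [show 1 + 1 / x = (x + 1) / x by field_simp, div_pow]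
    ring
  have hinv : 1 / (x + 1) ≤ 1 / x := by gcongr; linarith
  have hle : 1 / (x + 1) * k ≤ (x + 1) ^ k * (1 / x ^ k) - 1 := by
    rw [← hquot]
    nlinarith
  have hpow : 0 < (x + 1) ^ k := by positivity
  calc 1 / (x + 1) ^ (k + 1) = 1 / k * (1 / (x + 1) ^ k * (1 / (x + 1) * k)) := by
        rw [pow_succ]
        field_simp
    _ ≤ 1 / k * (1 / (x + 1) ^ k * ((x + 1) ^ k * (1 / x ^ k) - 1)) := by gcongr
    _ = 1 / k * (1 / x ^ k - 1 / (x + 1) ^ k) := by field_simp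

theorem tsum_one_div_add_three_pow_le {k : ℕ} (hk : 1 ≤ k) :
    ∑' n : ℕ, 1 / ((n + 3 : ℕ) : ℝ) ^ (k + 1) ≤ 1 / k * (1 / 2 ^ k) := by
  refine Real.tsum_le_of_sum_range_le (fun n => by positivity) fun N => ?_
  calc ∑ n ∈ Finset.range N, 1 / ((n + 3 : ℕ) : ℝ) ^ (k + 1)
      ≤ ∑ n ∈ Finset.range N,
          (1 / k * (1 / ((n : ℝ) + 2) ^ k) - 1 / k * (1 / (((n + 1 : ℕ) : ℝ) + 2) ^ k)) := by
        refine Finset.sum_le_sum fun n _ => ?_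
        have h := one_div_pow_succ_le_sub hk (x := (n : ℝ) + 2) (by positivity)
        rw [mul_sub] at h
        push_cast
        rwa [show (n : ℝ) + 3 = n + 2 + 1 by ring, show (n : ℝ) + 1 + 2 = n + 2 + 1 by ring]
    _ ≤ 1 / k * (1 / 2 ^ k) := by
        rw [Finset.sum_range_sub' (fun n : ℕ => 1 / (k : ℝ) * (1 / ((n : ℝ) + 2) ^ k))]
        have : 0 ≤ 1 / (k : ℝ) * (1 / ((N : ℝ) + 2) ^ k) := by positivity
        simpa using this

theorem riemannZeta_natCast_re_sub_one {k : ℕ} (hk : 1 < k) :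
    (riemannZeta k).re - 1 = 1 / 2 ^ k + ∑' n : ℕ, 1 / ((n + 3 : ℕ) : ℝ) ^ k := by
  rw [riemannZeta_natCast_re hk,
    ← (Real.summable_one_div_nat_pow.2 hk).sum_add_tsum_nat_add 3]
  have hk0 : k ≠ 0 := by lia
  simp [Finset.sum_range_succ, hk0]
  ring

theorem riemannZeta_natCast_re_sub_one_pos {k : ℕ} (hk : 1 < k) :
    0 < (riemannZeta k).re - 1 := by
  rw [riemannZeta_natCast_re_sub_one hk]
  have : 0 ≤ ∑' n : ℕ, 1 / ((n + 3 : ℕ) : ℝ) ^ k := tsum_nonneg fun n => by positivity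
  positivity

theorem riemannZeta_natCast_re_sub_one_le {k : ℕ} (hk : 1 ≤ k) :
    (riemannZeta (k + 1 : ℕ)).re - 1 ≤ (1 + 2 / k) * (1 / 2 ^ (k + 1)) := by
  rw [riemannZeta_natCast_re_sub_one (by lia)]
  have h := tsum_one_div_add_three_pow_le hk
  have : (1 + 2 / (k : ℝ)) * (1 / 2 ^ (k + 1)) = 1 / 2 ^ (k + 1) + 1 / k * (1 / 2 ^ k) := by
    rw [pow_succ]
    field_simp
  linarith

theorem C_pos {l : ℕ} (hl : 1 ≤ l) : 0 < C l := by
  have : (0 : ℝ) < l := by exact_mod_cast hl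
  unfold C
  positivity

theorem C_lt {l : ℕ} (hl : 1 ≤ l) : C l < 1 / (64 * 4 ^ l * (l : ℝ) ^ 4) := by
  have hl' : (0 : ℝ) < l := by exact_mod_cast hl
  unfold C
  refine one_div_lt_one_div_of_lt (by positivity) ?_
  have h4 : (0 : ℝ) < 4 ^ l := by positivity
  have hpoly : 64 * (l : ℝ) ^ 4 < 16 * (l * (l + 1) * (2 * l + 1) * (2 * l + 3)) := by
    have : 0 < 192 * (l : ℝ) ^ 3 + 176 * (l : ℝ) ^ 2 + 48 * l := by positivity
    linarith
  linarith [mul_lt_mul_of_pos_left hpoly h4]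

theorem C_mul_riemannZeta_sub_one_lt {m l : ℕ} (hl : m + 1 ≤ l) :
    C l * ((riemannZeta (2 * l : ℕ)).re - 1) <
      (1 + 2 / (2 * (m : ℝ) + 1)) * (1 / (2 ^ (4 * l + 6) * (l : ℝ) ^ 4)) := by
  have hpos := riemannZeta_natCast_re_sub_one_pos (k := 2 * l) (by lia)
  have hzeta : (riemannZeta (2 * l : ℕ)).re - 1 ≤
      (1 + 2 / (2 * (m : ℝ) + 1)) * (1 / 2 ^ (2 * l)) := by
    have h := riemannZeta_natCast_re_sub_one_le (k := 2 * l - 1) (by lia)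
    rw [show 2 * l - 1 + 1 = 2 * l by lia] at h
    have hm : 2 * (m : ℝ) + 1 ≤ (2 * l - 1 : ℕ) := by
      exact_mod_cast (by lia : 2 * m + 1 ≤ 2 * l - 1)
    refine h.trans ?_
    gcongr
  calc C l * ((riemannZeta (2 * l : ℕ)).re - 1)
      < 1 / (64 * 4 ^ l * (l : ℝ) ^ 4) * ((riemannZeta (2 * l : ℕ)).re - 1) :=
        mul_lt_mul_of_pos_right (C_lt (by lia)) hpos
    _ ≤ 1 / (64 * 4 ^ l * (l : ℝ) ^ 4) * ((1 + 2 / (2 * (m : ℝ) + 1)) * (1 / 2 ^ (2 * l))) := by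
        gcongr
    _ = (1 + 2 / (2 * (m : ℝ) + 1)) * (1 / (2 ^ (4 * l + 6) * (l : ℝ) ^ 4)) := by
        have hpow : (2 : ℝ) ^ (4 * l + 6) = 64 * 4 ^ l * 2 ^ (2 * l) := by
          rw [show (4 : ℝ) = 2 ^ 2 by norm_num, ← pow_mul]
          ring
        rw [hpow]
        ring

theorem summable_one_div_two_pow_mul_pow (m : ℕ) :
    Summable fun l : ℕ =>
      1 / ((2 : ℝ) ^ (4 * (l + m + 1) + 6) * ((l + m + 1 : ℕ) : ℝ) ^ 4) := by
  refine Summable.of_nonneg_of_le (fun l => by positivity) (fun l => ?_) summable_geometric_two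
  rw [one_div_pow]
  refine one_div_le_one_div_of_le (by positivity) ?_
  have hpow : (2 : ℝ) ^ l ≤ 2 ^ (4 * (l + m + 1) + 6) :=
    pow_le_pow_right₀ (by norm_num) (by lia)
  have hone : (1 : ℝ) ≤ ((l + m + 1 : ℕ) : ℝ) ^ 4 :=
    one_le_pow₀ (by exact_mod_cast (by lia : 1 ≤ l + m + 1))
  exact hpow.trans (le_mul_of_one_le_right (by positivity) hone)

theorem truncation_error_bound (m : ℕ) (hm : 1 ≤ m) :
    (∑' l : ℕ, C (l + m + 1) * ((riemannZeta (2 * (l + m + 1) : ℕ)).re - 1)) <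
      (1 + 2 / (2 * (m : ℝ) + 1)) *
        ∑' l : ℕ, 1 / ((2 : ℝ) ^ (4 * (l + m + 1) + 6) * ((l + m + 1 : ℕ) : ℝ) ^ 4) := by
  have hlt (l : ℕ) := C_mul_riemannZeta_sub_one_lt (m := m) (l := l + m + 1) (by lia)
  have hsum := (summable_one_div_two_pow_mul_pow m).mul_left (1 + 2 / (2 * (m : ℝ) + 1))
  rw [← tsum_mul_left]
  refine Summable.tsum_lt_tsum (i := 0) (fun l => (hlt l).le) (hlt 0) ?_ hsum
  exact hsum.of_nonneg_of_le (fun l => mul_nonneg (C_pos (by lia)).le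
    (riemannZeta_natCast_re_sub_one_pos (by lia)).le) fun l => (hlt l).le
end

section
/- For every positive integer n, the derivative of the Riemann zeta function at the odd negative integer -2n+1 satisfies ζ'(-2n+1) = 2·(-1)^{n+1} / (2π)^{2n} · Γ(2n) · [ ζ'(2n) + ζ(2n)·( ψ(2n) - ln(2π) ) ], where ψ(2n) = Γ'(2n)/Γ(2n) is the digamma function at 2n. -/
open Real

theorem hasDerivAt_cos_pi_mul_div_two (n : ℕ) :
    HasDerivAt (fun s : ℂ ↦ Complex.cos (π * s / 2)) 0 (2 * n) := by
  have h : HasDerivAt (fun s : ℂ ↦ π * s / 2) ((π : ℂ) / 2) (2 * n) := by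
    simpa using ((hasDerivAt_id (2 * n : ℂ)).const_mul (π : ℂ)).div_const 2
  have hsin : Complex.sin (π * (2 * n) / 2) = 0 := by
    rw [show (π : ℂ) * (2 * n) / 2 = n * π by ring, Complex.sin_nat_mul_pi]
  simpa [hsin] using h.ccos

theorem deriv_zeta_neg_odd (n : ℕ) (hn : 1 ≤ n) :
    deriv riemannZeta (-2 * (n : ℂ) + 1) =
      2 * (-1) ^ (n + 1) / (2 * (π : ℂ)) ^ (2 * n) * Complex.Gamma (2 * n) *
        (deriv riemannZeta (2 * n) +
          riemannZeta (2 * n) *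
            (deriv Complex.Gamma (2 * n) / Complex.Gamma (2 * n) -
              (Real.log (2 * π) : ℂ))) := by
  have hre : 1 < (2 * n : ℂ).re := by
    have : (1 : ℝ) ≤ n := by exact_mod_cast hn
    simp
    linarith
  have hne_of_re {s : ℂ} (hs : 1 < s.re) : (∀ m : ℕ, s ≠ -m) ∧ s ≠ 1 := by
    refine ⟨fun m h ↦ ?_, fun h ↦ ?_⟩
    · have hm : (0 : ℝ) ≤ m := m.cast_nonneg
      rw [h, Complex.neg_re, Complex.natCast_re] at hs
      linarith
    · simp [h] at hs
  obtain ⟨hnat, hone⟩ := hne_of_re hre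
  have hpi : (2 * π : ℂ) ≠ 0 := by exact_mod_cast two_pi_pos.ne'
  have hΓ : Complex.Gamma (2 * n) ≠ 0 := Complex.Gamma_ne_zero hnat
  have hfe : (fun s ↦ riemannZeta (1 - s)) =ᶠ[nhds (2 * n : ℂ)] fun s ↦
      2 * (2 * π : ℂ) ^ (-s) * Complex.Gamma s * Complex.cos (π * s / 2) * riemannZeta s := by
    filter_upwards [(isOpen_lt continuous_const Complex.continuous_re).mem_nhds hre] with s hs
    exact riemannZeta_one_sub (hne_of_re hs).1 (hne_of_re hs).2
  have hleft : deriv (fun s ↦ riemannZeta (1 - s)) (2 * n : ℂ) =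
      -deriv riemannZeta (-2 * (n : ℂ) + 1) := by
    rw [deriv_comp_const_sub]
    congr 2
    ring
  have hpow : HasDerivAt (fun s : ℂ ↦ (2 * π : ℂ) ^ (-s))
      (-((2 * π : ℂ) ^ (-(2 * n : ℂ)) * Complex.log (2 * π))) (2 * n) := by
    simpa using (hasDerivAt_neg (2 * n : ℂ)).const_cpow (Or.inl hpi)
  have hright := ((((hpow.const_mul 2).mul
    (Complex.differentiableAt_Gamma _ hnat).hasDerivAt).mul
    (hasDerivAt_cos_pi_mul_div_two n)).mul (differentiableAt_riemannZeta hone).hasDerivAt)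
  have hcos : Complex.cos (π * (2 * n) / 2) = (-1) ^ n := by
    rw [show (π : ℂ) * (2 * n) / 2 = n * π by ring]
    exact_mod_cast congrArg Complex.ofReal (Real.cos_nat_mul_pi n)
  have hcpow : (2 * π : ℂ) ^ (-(2 * n : ℂ)) = ((2 * π : ℂ) ^ (2 * n))⁻¹ := by
    rw [Complex.cpow_neg, ← Complex.cpow_natCast]
    push_cast
    rfl
  have hlog : Complex.log (2 * π) = (Real.log (2 * π) : ℂ) := by
    rw [Complex.ofReal_log two_pi_pos.le]
    push_cast
    rfl
  have key := hfe.deriv_eq.trans hright.deriv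
  simp only [Pi.mul_apply] at key
  rw [hleft, hcos, hcpow, hlog] at key
  rw [← neg_neg (deriv riemannZeta _), key]
  field_simp
  ring
end
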